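/- If Γ is a superstable graph (all valencies ≥ 3 except possibly loop vertices) with 2 ∉ B_Γ, and Γ = Γ₁ ∪ Γ₂ with disjoint edge sets and at most one common vertex with both Γ_i nonempty, then a contradiction follows; i.e., Γ is connected and has no separating vertices. -/

import Mathlib

/-!
A finite multigraph on vertex type `V` with edge type `E`: each edge has a
(possibly diagonal, i.e. loop) unordered pair of endpoints in `Sym2 V`.
-/
structure Multigraph (V E : Type) where
  ends : E → Sym2 V

namespace Multigraph

variable {V E : Type} [Fintype V] [Fintype E] [DecidableEq V] [DecidableEq E]
variable (G : Multigraph V E)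

/-- Valency of the vertex `v` in the subgraph with edge set `Δ`; a loop counts twice. -/
def deg (Δ : Finset E) (v : V) : ℕ :=
  ∑ e ∈ Δ, (if G.ends e = Sym2.diag v then 2 else if v ∈ G.ends e then 1 else 0)

/-- `Δ` is a cyclic subgraph (even subset of edges): all valencies are even. -/
def IsCyclic (Δ : Finset E) : Prop := ∀ v, Even (G.deg Δ v)

instance (Δ : Finset E) : Decidable (G.IsCyclic Δ) :=
  decidable_of_iff (∀ v, Even (G.deg Δ v)) Iff.rfl

/-- Vertices of the subgraph generated by the edge set `Δ`. -/
def verts (Δ : Finset E) : Finset V :=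
  Finset.univ.filter (fun v => ∃ e ∈ Δ, v ∈ G.ends e)

/-- Adjacency through an edge of `Δ`. -/
def Adj (Δ : Finset E) (v w : V) : Prop := ∃ e ∈ Δ, G.ends e = s(v, w)

/-- Connectedness relation of the subgraph with edge set `Δ`. -/
def Reach (Δ : Finset E) : V → V → Prop := Relation.ReflTransGen (G.Adj Δ)

/-- Number of connected components of the subgraph generated by `Δ`
(only vertices incident to an edge of `Δ` are taken into account). -/
noncomputable def ncomp (Δ : Finset E) : ℕ :=
  Set.ncard { S : Set V | ∃ v ∈ G.verts Δ, S = {w | G.Reach Δ v w} }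

/-- Number of connected components of the spanning subgraph `(V, Δ)`. -/
noncomputable def ncompSpanning (Δ : Finset E) : ℕ :=
  Set.ncard { S : Set V | ∃ v : V, S = {w | G.Reach Δ v w} }

/-- First Betti number `|E(Δ)| - |V(Δ)| + c(Δ)` of the subgraph generated by `Δ`. -/
noncomputable def b1 (Δ : Finset E) : ℤ :=
  (Δ.card : ℤ) - (G.verts Δ).card + G.ncomp Δ

/-- The set of cyclic Betti numbers `B_Γ = {b₁(Δ) | Δ cyclic}`. -/
noncomputable def B : Set ℤ := { n | ∃ Δ : Finset E, G.IsCyclic Δ ∧ G.b1 Δ = n }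

/-- The boundary of an `𝔽₂` 1-chain: an edge is sent to the sum of its endpoints
(so a loop is sent to `0`). -/
def bndFun (x : E → ZMod 2) (v : V) : ZMod 2 :=
  ∑ e : E, x e * (if (G.ends e).IsDiag then 0 else if v ∈ G.ends e then 1 else 0)

/-- The boundary operator as an `𝔽₂`-linear map. -/
def bnd : (E → ZMod 2) →ₗ[ZMod 2] (V → ZMod 2) where
  toFun := G.bndFun
  map_add' x y := by
    funext v
    simp only [bndFun, Pi.add_apply, ← Finset.sum_add_distrib]
    exact Finset.sum_congr rfl fun e _ => by ring
  map_smul' c x := by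
    funext v
    simp only [bndFun, Pi.smul_apply, smul_eq_mul, Finset.mul_sum, RingHom.id_apply]
    exact Finset.sum_congr rfl fun e _ => by ring

/-- The cycle space `𝒞_Γ = ker ∂`. -/
def cycleSpace : Submodule (ZMod 2) (E → ZMod 2) := LinearMap.ker G.bnd

/-- The `𝔽₂` 1-chain associated to a set of edges. -/
def chainOf (Δ : Finset E) : E → ZMod 2 := fun e => if e ∈ Δ then 1 else 0

/-- Chains supported on a subset `E'` of the edges. -/
def supportedOn (E' : Finset E) : Submodule (ZMod 2) (E → ZMod 2) where
  carrier := {x | ∀ e, e ∉ E' → x e = 0}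
  add_mem' := by intro x y hx hy e he; simp [hx e he, hy e he]
  zero_mem' := by intro e he; rfl
  smul_mem' := by intro c x hx e he; simp [hx e he]

/-- The cycle space of the subgraph of `G` with edge set `E'`. -/
def cycleSpaceOn (E' : Finset E) : Submodule (ZMod 2) (E → ZMod 2) :=
  G.cycleSpace ⊓ supportedOn E'

/-- The set of cyclic Betti numbers of the subgraph with edge set `E'`. -/
noncomputable def BOn (E' : Finset E) : Set ℤ :=
  { n | ∃ Δ ⊆ E', G.IsCyclic Δ ∧ G.b1 Δ = n }

/-- `N` is a separating edge: deleting it increases the number of connected components. -/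
def Separating (N : E) : Prop :=
  G.ncompSpanning Finset.univ < G.ncompSpanning (Finset.univ \ {N})

/-- `G` is eulerian: every valency is even. -/
def Eulerian : Prop := ∀ v, Even (G.deg Finset.univ v)

/-- `G` is superstable: every vertex has valency at least `3`, except possibly
a vertex carrying a loop. -/
def Superstable : Prop :=
  ∀ v ∈ G.verts Finset.univ, 3 ≤ G.deg Finset.univ v ∨ ∃ e : E, G.ends e = Sym2.diag v

/-- A circuit: a nonempty connected subgraph all of whose valencies equal `2`. -/
def IsCircuit (Δ : Finset E) : Prop :=
  Δ.Nonempty ∧ (∀ v ∈ G.verts Δ, G.deg Δ v = 2) ∧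
    ∀ v ∈ G.verts Δ, ∀ w ∈ G.verts Δ, G.Reach Δ v w

/-- `G` is connected. -/
def Conn : Prop :=
  ∀ v ∈ G.verts Finset.univ, ∀ w ∈ G.verts Finset.univ, G.Reach Finset.univ v w

/-- The edges of `G` that are not separating. -/
noncomputable def nonSepEdges : Finset E :=
  @Finset.filter _ (fun N => ¬ G.Separating N) (Classical.decPred _) Finset.univ

end Multigraph
namespace Multigraph

variable {V E : Type} (G : Multigraph V E)

theorem Reach.mono {Δ Δ' : Finset E} (h : Δ ⊆ Δ') {v w : V} (hr : G.Reach Δ v w) :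
    G.Reach Δ' v w :=
  Relation.ReflTransGen.mono (fun _ _ ⟨e, he, hve⟩ => ⟨e, h he, hve⟩) _ _ hr

theorem Reach.symm {Δ : Finset E} {v w : V} (hr : G.Reach Δ v w) : G.Reach Δ w v :=
  have : Std.Symm (G.Adj Δ) := ⟨fun _ _ ⟨e, he, hve⟩ => ⟨e, he, hve.trans Sym2.eq_swap⟩⟩
  Relation.ReflTransGen.stdSymm.symm _ _ hr

theorem reach_of_mem_ends {Δ : Finset E} {e : E} (he : e ∈ Δ) {v w : V} (hv : v ∈ G.ends e)
    (hw : w ∈ G.ends e) : G.Reach Δ v w := by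
  by_cases h : v = w
  · subst h; exact Relation.ReflTransGen.refl
  · exact Relation.ReflTransGen.single ⟨e, he, (Sym2.mem_and_mem_iff h).1 ⟨hv, hw⟩⟩

variable [DecidableEq V]

/-- The number of ends of the edge `e` at the vertex `v`. -/
def inc (e : E) (v : V) : ℕ :=
  if G.ends e = Sym2.diag v then 2 else if v ∈ G.ends e then 1 else 0

theorem deg_eq_sum_inc (Δ : Finset E) (v : V) : G.deg Δ v = ∑ e ∈ Δ, G.inc e v := rfl

theorem inc_eq_zero {e : E} {v : V} (h : v ∉ G.ends e) : G.inc e v = 0 := by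
  have : G.ends e ≠ Sym2.diag v := fun h' => h (by rw [h']; simp [Sym2.diag])
  simp [inc, h, this]

theorem inc_pos {e : E} {v : V} (h : v ∈ G.ends e) : 0 < G.inc e v := by
  unfold inc; split_ifs <;> simp

theorem deg_subset {Δ Δ' : Finset E} {v : V} (h : Δ ⊆ Δ')
    (hv : ∀ e ∈ Δ', v ∈ G.ends e → e ∈ Δ) : G.deg Δ v = G.deg Δ' v :=
  Finset.sum_subset h fun e he hne => G.inc_eq_zero fun hve => hne (hv e he hve)

theorem deg_union [DecidableEq E] {Δ Δ' : Finset E} (h : Disjoint Δ Δ') (v : V) :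
    G.deg (Δ ∪ Δ') v = G.deg Δ v + G.deg Δ' v :=
  Finset.sum_union h

variable [Fintype V]

theorem mem_verts {Δ : Finset E} {v : V} : v ∈ G.verts Δ ↔ ∃ e ∈ Δ, v ∈ G.ends e := by
  simp [verts]

theorem sum_inc {Δ : Finset E} {e : E} (he : e ∈ Δ) :
    ∑ v ∈ G.verts Δ, G.inc e v = 2 := by
  induction h : G.ends e using Sym2.ind with
  | _ a b =>
    have hsub : ({a, b} : Finset V) ⊆ G.verts Δ := by
      intro v hv
      exact G.mem_verts.2 ⟨e, he, by simpa [h] using hv⟩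
    rw [← Finset.sum_subset hsub fun v _ hv => G.inc_eq_zero (by simpa [h] using hv)]
    by_cases hab : a = b
    · subst hab
      simp [inc, h, Sym2.diag]
    · rw [Finset.sum_pair hab]
      have ha : ¬ (b = a) := fun h' => hab h'.symm
      simp [inc, h, Sym2.diag, hab, ha]

/-- The handshake lemma. -/
theorem sum_deg (Δ : Finset E) : ∑ v ∈ G.verts Δ, G.deg Δ v = 2 * Δ.card := by
  simp only [deg_eq_sum_inc]
  rw [Finset.sum_comm, Finset.sum_congr rfl fun e he => G.sum_inc he]
  simp [mul_comm]

theorem deg_pos {Δ : Finset E} {v : V} (hv : v ∈ G.verts Δ) : 0 < G.deg Δ v := by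
  obtain ⟨e, he, hve⟩ := G.mem_verts.1 hv
  exact (G.inc_pos hve).trans_le
    (Finset.single_le_sum (f := fun e => G.inc e v) (fun _ _ => Nat.zero_le _) he)

theorem verts_mono {Δ Δ' : Finset E} (h : Δ ⊆ Δ') : G.verts Δ ⊆ G.verts Δ' := by
  intro v hv
  obtain ⟨e, he, hve⟩ := G.mem_verts.1 hv
  exact G.mem_verts.2 ⟨e, h he, hve⟩

theorem verts_union [DecidableEq E] (Δ Δ' : Finset E) :
    G.verts (Δ ∪ Δ') = G.verts Δ ∪ G.verts Δ' := by
  ext v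
  simp only [mem_verts, Finset.mem_union, or_and_right, exists_or]

theorem verts_nonempty {Δ : Finset E} (h : Δ.Nonempty) : (G.verts Δ).Nonempty := by
  obtain ⟨e, he⟩ := h
  obtain ⟨a, ha⟩ : ∃ a, a ∈ G.ends e := ⟨_, (G.ends e).out_fst_mem⟩
  exact ⟨a, G.mem_verts.2 ⟨e, he, ha⟩⟩

theorem deg_eq_zero {Δ : Finset E} {v : V} (hv : v ∉ G.verts Δ) : G.deg Δ v = 0 :=
  Finset.sum_eq_zero fun e he => G.inc_eq_zero fun hve => hv (G.mem_verts.2 ⟨e, he, hve⟩)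

/-- A nonempty graph with at least as many edges as vertices contains a nonempty cyclic
subgraph. -/
theorem exists_isCyclic {Δ : Finset E} (hne : Δ.Nonempty)
    (hcard : (G.verts Δ).card ≤ Δ.card) :
    ∃ S ⊆ Δ, S.Nonempty ∧ G.IsCyclic S := by
  let f : (Δ → ZMod 2) →+ (G.verts Δ → ZMod 2) :=
    { toFun := fun x v => ∑ e, x e * (G.inc e v : ZMod 2)
      map_zero' := by ext; simp
      map_add' := by intro x y; ext; simp [add_mul, Finset.sum_add_distrib] }
  have hf : ∀ x v, f x v = ∑ e, x e * (G.inc e v : ZMod 2) := fun _ _ => rfl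
  have hninj : ¬ Function.Injective f := by
    intro hinj
    have hsurj : Function.Surjective f :=
      (hinj.bijective_of_nat_card_le (by
        simpa [Nat.card_fun] using Nat.pow_le_pow_right (n := 2) (by norm_num) hcard)).2
    obtain ⟨v, hv⟩ := G.verts_nonempty hne
    obtain ⟨x, hx⟩ := hsurj (Pi.single ⟨v, hv⟩ 1)
    have h1 : ∑ u, f x u = 1 := by rw [hx]; simp
    have h0 : ∑ u, f x u = 0 := by
      simp only [hf]
      rw [Finset.sum_comm]
      refine Finset.sum_eq_zero fun e _ => ?_
      rw [← Finset.mul_sum, ← Nat.cast_sum, Finset.sum_coe_sort (G.verts Δ) (G.inc e),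
        G.sum_inc e.2]
      exact mul_eq_zero_of_right _ (by decide)
    exact zero_ne_one (h0.symm.trans h1)
  rw [injective_iff_map_eq_zero] at hninj
  push Not at hninj
  obtain ⟨x, hx, hx0⟩ := hninj
  have hsub : (Finset.univ.filter fun e => x e ≠ 0).map (Function.Embedding.subtype _) ⊆ Δ := by
    intro e he
    obtain ⟨e', -, rfl⟩ := Finset.mem_map.1 he
    exact e'.2
  refine ⟨_, hsub, ?_, fun v => ?_⟩
  · obtain ⟨e, he⟩ := Function.ne_iff.1 hx0
    exact ⟨e, Finset.mem_map.2 ⟨e, by simpa using he, rfl⟩⟩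
  · by_cases hv : v ∈ G.verts Δ
    · have h : f x ⟨v, hv⟩ = 0 := congrFun hx ⟨v, hv⟩
      rw [← ZMod.natCast_eq_zero_iff_even, deg_eq_sum_inc, Finset.sum_map, Nat.cast_sum,
        Finset.sum_filter]
      refine Eq.trans ?_ h
      rw [hf]
      refine Finset.sum_congr rfl fun e _ => ?_
      have h01 : ∀ a : ZMod 2, a = 0 ∨ a = 1 := by decide
      rcases h01 (x e) with h | h <;> simp [h]
    · rw [G.deg_eq_zero fun h => hv (G.verts_mono hsub h)]
      exact Even.zero

/-- A nonempty graph with at least as many edges as vertices contains a nonempty connected cyclic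
subgraph with exactly as many edges as vertices. -/
theorem exists_connected_isCyclic {Δ : Finset E} (hne : Δ.Nonempty)
    (hcard : (G.verts Δ).card ≤ Δ.card) :
    ∃ S ⊆ Δ, S.Nonempty ∧ G.IsCyclic S ∧ S.card = (G.verts S).card ∧
      ∀ v ∈ G.verts S, ∀ w ∈ G.verts S, G.Reach S v w := by
  classical
  obtain ⟨S₀, hS₀, hS₀'⟩ := G.exists_isCyclic hne hcard
  obtain ⟨S, hSS₀, hS⟩ := exists_minimal_le_of_wellFoundedLT
    (fun S : Finset E => S.Nonempty ∧ G.IsCyclic S) S₀ hS₀'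
  obtain ⟨⟨hSne, hScyc⟩, hmin⟩ := hS
  have hmin : ∀ T ⊆ S, T.Nonempty → G.IsCyclic T → T = S := fun T hT h1 h2 =>
    Finset.Subset.antisymm hT (hmin ⟨h1, h2⟩ hT)
  refine ⟨S, hSS₀.trans hS₀, hSne, hScyc, le_antisymm ?_ ?_, fun v hv w hw => ?_⟩
  · by_contra! hlt
    obtain ⟨e, he⟩ := hSne
    have hpos := (G.verts_nonempty ⟨e, he⟩).card_pos
    have hcard' := Finset.card_erase_of_mem he
    obtain ⟨T, hT, hTne, hTc⟩ := G.exists_isCyclic (Δ := S.erase e)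
      (Finset.card_pos.1 (by omega))
      ((Finset.card_le_card (G.verts_mono (Finset.erase_subset e S))).trans (by omega))
    have := hmin T (hT.trans (Finset.erase_subset e S)) hTne hTc
    subst this
    exact Finset.notMem_erase e T (hT he)
  · have h : ∑ v ∈ G.verts S, 2 ≤ ∑ v ∈ G.verts S, G.deg S v := by
      refine Finset.sum_le_sum fun v hv => ?_
      obtain ⟨k, hk⟩ := hScyc v
      have := G.deg_pos hv
      omega
    rw [sum_deg] at h
    simp at h
    omega
  · have hT : S.filter (fun e => ∀ u ∈ G.ends e, G.Reach S v u) = S := by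
      refine hmin _ (Finset.filter_subset _ _) ?_ fun u => ?_
      · obtain ⟨e, he, hve⟩ := G.mem_verts.1 hv
        exact ⟨e, Finset.mem_filter.2 ⟨he, fun u hu => G.reach_of_mem_ends he hve hu⟩⟩
      · by_cases hu : G.Reach S v u
        · rw [G.deg_subset (Finset.filter_subset _ S) fun e he hue => ?_]
          · exact hScyc u
          · exact Finset.mem_filter.2
              ⟨he, fun u' hu' => hu.trans (G.reach_of_mem_ends he hue hu')⟩
        · rw [G.deg_eq_zero]
          · exact Even.zero
          · intro h
            obtain ⟨e, he, hue⟩ := G.mem_verts.1 h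
            exact hu ((Finset.mem_filter.1 he).2 u hue)
    obtain ⟨e, he, hwe⟩ := G.mem_verts.1 hw
    rw [← hT] at he
    exact (Finset.mem_filter.1 he).2 w hwe

theorem ncomp_eq_one {Δ : Finset E} {u : V} (hu : u ∈ G.verts Δ)
    (h : ∀ v ∈ G.verts Δ, G.Reach Δ v u) : G.ncomp Δ = 1 := by
  rw [ncomp, Set.ncard_eq_one]
  refine ⟨{w | G.Reach Δ u w}, Set.eq_singleton_iff_unique_mem.2 ⟨⟨u, hu, rfl⟩, ?_⟩⟩
  rintro _ ⟨v, hv, rfl⟩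
  ext w
  exact ⟨fun hw => (Reach.symm G (h v hv)).trans hw, fun hw => (h v hv).trans hw⟩

theorem setOf_reach_union [DecidableEq E] {Δ Δ' : Finset E}
    (hd : Disjoint (G.verts Δ) (G.verts Δ'))
    (hconn : ∀ v ∈ G.verts Δ, ∀ w ∈ G.verts Δ, G.Reach Δ v w) {v : V} (hv : v ∈ G.verts Δ) :
    {w | G.Reach (Δ ∪ Δ') v w} = (G.verts Δ : Set V) := by
  ext w
  refine ⟨fun hw => ?_, fun hw => Reach.mono G Finset.subset_union_left (hconn v hv w hw)⟩
  simp only [Set.mem_ofPred_eq] at hw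
  induction hw with
  | refl => exact hv
  | @tail a b _ hab ih =>
    obtain ⟨e, he, hab⟩ := hab
    rcases Finset.mem_union.1 he with he | he
    · exact G.mem_verts.2 ⟨e, he, by simp [hab]⟩
    · exact absurd (G.mem_verts.2 ⟨e, he, by simp [hab]⟩) (Finset.disjoint_left.1 hd ih)

theorem ncomp_union_of_disjoint [DecidableEq E] {Δ Δ' : Finset E}
    (hne : Δ.Nonempty) (hne' : Δ'.Nonempty)
    (hd : Disjoint (G.verts Δ) (G.verts Δ'))
    (hconn : ∀ v ∈ G.verts Δ, ∀ w ∈ G.verts Δ, G.Reach Δ v w)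
    (hconn' : ∀ v ∈ G.verts Δ', ∀ w ∈ G.verts Δ', G.Reach Δ' v w) :
    G.ncomp (Δ ∪ Δ') = 2 := by
  obtain ⟨a, ha⟩ := G.verts_nonempty hne
  obtain ⟨b, hb⟩ := G.verts_nonempty hne'
  have h : ∀ v ∈ G.verts Δ, {w | G.Reach (Δ ∪ Δ') v w} = (G.verts Δ : Set V) := fun v hv =>
    G.setOf_reach_union hd hconn hv
  have h' : ∀ v ∈ G.verts Δ', {w | G.Reach (Δ ∪ Δ') v w} = (G.verts Δ' : Set V) := fun v hv =>
    Finset.union_comm Δ' Δ ▸ G.setOf_reach_union hd.symm hconn' hv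
  rw [ncomp, Set.ncard_eq_two]
  refine ⟨G.verts Δ, G.verts Δ', fun heq => ?_, ?_⟩
  · exact Finset.disjoint_left.1 hd ha (Finset.coe_injective heq ▸ ha)
  · ext A
    simp only [Set.mem_ofPred_eq, verts_union, Finset.mem_union, Set.mem_insert_iff,
      Set.mem_singleton_iff]
    constructor
    · rintro ⟨v, hv | hv, rfl⟩
      · exact Or.inl (h v hv)
      · exact Or.inr (h' v hv)
    · rintro (rfl | rfl)
      · exact ⟨a, Or.inl ha, (h a ha).symm⟩
      · exact ⟨b, Or.inr hb, (h' b hb).symm⟩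

theorem Superstable.two_le_deg [Fintype E] {G : Multigraph V E} (hss : G.Superstable) {v : V}
    (hv : v ∈ G.verts Finset.univ) : 2 ≤ G.deg Finset.univ v := by
  rcases hss v hv with h | ⟨e, he⟩
  · omega
  · calc 2 = G.inc e v := by simp [inc, he]
      _ ≤ _ := Finset.single_le_sum (f := fun e => G.inc e v) (fun _ _ => Nat.zero_le _)
        (Finset.mem_univ e)

/-- A part of a superstable graph meeting the rest in at most one vertex has at least as many
edges as vertices. -/
theorem Superstable.card_verts_le [Fintype E] [DecidableEq E] {G : Multigraph V E}
    (hss : G.Superstable) {E₁ E₂ : Finset E} (hunion : E₁ ∪ E₂ = Finset.univ)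
    (hvert : (G.verts E₁ ∩ G.verts E₂).card ≤ 1) :
    (G.verts E₁).card ≤ E₁.card := by
  have key : ∀ v ∈ G.verts E₁, 2 ≤ G.deg E₁ v + if v ∈ G.verts E₂ then 1 else 0 := by
    intro v hv
    split_ifs with h
    · have := G.deg_pos hv
      omega
    · rw [G.deg_subset (Finset.subset_univ E₁) fun e he hve => ?_]
      · exact hss.two_le_deg (G.verts_mono (Finset.subset_univ _) hv)
      · rw [← hunion, Finset.mem_union] at he
        exact he.resolve_right fun he => h (G.mem_verts.2 ⟨e, he, hve⟩)
  have := Finset.sum_le_sum key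
  rw [Finset.sum_add_distrib, sum_deg, ← Finset.sum_filter, Finset.filter_mem_eq_inter] at this
  simp at this
  omega

end Multigraph

/-- A superstable graph with `2 ∉ B_Γ` admits no decomposition `Γ = Γ₁ ∪ Γ₂`
into nonempty subgraphs with disjoint edge sets and at most one common vertex;
i.e. it is connected and has no separating vertices. -/
theorem superstable_no_separating_vertex {V E : Type} [Fintype V] [Fintype E]
    [DecidableEq V] [DecidableEq E] (G : Multigraph V E)
    (hss : G.Superstable) (h2 : (2 : ℤ) ∉ G.B)
    (E₁ E₂ : Finset E) (hne₁ : E₁.Nonempty) (hne₂ : E₂.Nonempty)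
    (hunion : E₁ ∪ E₂ = Finset.univ) (hdisj : Disjoint E₁ E₂)
    (hvert : (G.verts E₁ ∩ G.verts E₂).card ≤ 1) :
    False := by
  obtain ⟨S, hS, hSne, hScyc, hScard, hSconn⟩ :=
    G.exists_connected_isCyclic hne₁ (hss.card_verts_le hunion hvert)
  obtain ⟨T, hT, hTne, hTcyc, hTcard, hTconn⟩ :=
    G.exists_connected_isCyclic hne₂ (hss.card_verts_le (Finset.union_comm E₁ E₂ ▸ hunion)
      (Finset.inter_comm (G.verts E₁) _ ▸ hvert))
  have hST : Disjoint S T := Finset.disjoint_of_subset_left hS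
    (Finset.disjoint_of_subset_right hT hdisj)
  refine h2 ⟨S ∪ T, fun v => ?_, ?_⟩
  · rw [G.deg_union hST]
    exact (hScyc v).add (hTcyc v)
  have hle : (G.verts S ∩ G.verts T).card ≤ 1 :=
    (Finset.card_le_card (Finset.inter_subset_inter (G.verts_mono hS) (G.verts_mono hT))).trans
      hvert
  have hVcard := Finset.card_union_add_card_inter (G.verts S) (G.verts T)
  rw [Multigraph.b1, Finset.card_union_of_disjoint hST, G.verts_union]
  rcases Finset.eq_empty_or_nonempty (G.verts S ∩ G.verts T) with h | ⟨u, hu⟩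
  · rw [G.ncomp_union_of_disjoint hSne hTne (Finset.disjoint_iff_inter_eq_empty.2 h) hSconn
      hTconn]
    rw [h, Finset.card_empty] at hVcard
    omega
  · have hpos := Finset.card_pos.2 ⟨u, hu⟩
    obtain ⟨huS, huT⟩ := Finset.mem_inter.1 hu
    rw [G.ncomp_eq_one (u := u) (G.verts_mono Finset.subset_union_left huS) fun v hv => ?_]
    · omega
    · rw [G.verts_union, Finset.mem_union] at hv
      rcases hv with hv | hv
      · exact Multigraph.Reach.mono G Finset.subset_union_left (hSconn v hv u huS)
      · exact Multigraph.Reach.mono G Finset.subset_union_right (hTconn v hv u huT)
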